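/- There is no deterministic, truthful, and proportional cake-cutting mechanism for two agents, even when each agent's value density function is piecewise-constant and strictly positive everywhere, and even if the mechanism is allowed to leave part of the cake unallocated. -/

import Mathlib

open MeasureTheory Set
open scoped Classical

/-- The value of set `X` under value density function `f`. -/
noncomputable def val (f : ℝ → ℝ) (X : Set ℝ) : ℝ := ∫ t in X, f t

/-- `f` is piecewise constant on `[0,1]`. -/
def PWC (f : ℝ → ℝ) : Prop :=
  ∃ m : ℕ, ∃ t : ℕ → ℝ, t 0 = 0 ∧ t m = 1 ∧ (∀ j < m, t j < t (j + 1)) ∧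
    ∀ j < m, ∀ x ∈ Set.Ico (t j) (t (j + 1)), f x = f (t j)

/-- A valid report: piecewise constant, strictly positive on the cake (hungry), nonnegative. -/
def ValidPC (f : ℝ → ℝ) : Prop :=
  PWC f ∧ (∀ x ∈ Set.Icc (0:ℝ) 1, 0 < f x) ∧ (∀ x, 0 ≤ f x)

/-- Integral over the cake. -/
noncomputable def JI (f : ℝ → ℝ) : ℝ := ∫ x in Set.Icc (0:ℝ) 1, f x

/-- Bounded measurable functions. -/
def BM (f : ℝ → ℝ) : Prop := Measurable f ∧ ∃ C : ℝ, ∀ x, |f x| ≤ C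

lemma BM.add {f g : ℝ → ℝ} (hf : BM f) (hg : BM g) : BM (fun x => f x + g x) := by
  obtain ⟨hf, C, hC⟩ := hf
  obtain ⟨hg, D, hD⟩ := hg
  exact ⟨hf.add hg, C + D, fun x => (abs_add_le _ _).trans (add_le_add (hC x) (hD x))⟩

lemma BM.sub {f g : ℝ → ℝ} (hf : BM f) (hg : BM g) : BM (fun x => f x - g x) := by
  obtain ⟨hf, C, hC⟩ := hf
  obtain ⟨hg, D, hD⟩ := hg
  exact ⟨hf.sub hg, C + D, fun x => (abs_sub _ _).trans (add_le_add (hC x) (hD x))⟩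

lemma BM.mul {f g : ℝ → ℝ} (hf : BM f) (hg : BM g) : BM (fun x => f x * g x) := by
  obtain ⟨hf, C, hC⟩ := hf
  obtain ⟨hg, D, hD⟩ := hg
  refine ⟨hf.mul hg, C * D, fun x => ?_⟩
  rw [abs_mul]
  exact mul_le_mul (hC x) (hD x) (abs_nonneg _) ((abs_nonneg _).trans (hC x))

lemma BM.const (c : ℝ) : BM (fun _ => c) := ⟨measurable_const, |c|, fun _ => le_rfl⟩

lemma BM.abs {f : ℝ → ℝ} (hf : BM f) : BM (fun x => |f x|) := by
  obtain ⟨hf, C, hC⟩ := hf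
  exact ⟨hf.abs, C, fun x => by rw [abs_abs]; exact hC x⟩

lemma BM.int {f : ℝ → ℝ} (hf : BM f) : IntegrableOn f (Set.Icc (0:ℝ) 1) := by
  obtain ⟨hf, C, hC⟩ := hf
  exact Measure.integrableOn_of_bounded (M := C) (by simp) hf.aestronglyMeasurable
    (Filter.Eventually.of_forall hC)

lemma JI_add {f g : ℝ → ℝ} (hf : BM f) (hg : BM g) :
    JI (fun x => f x + g x) = JI f + JI g := integral_add hf.int hg.int

lemma JI_sub {f g : ℝ → ℝ} (hf : BM f) (hg : BM g) :
    JI (fun x => f x - g x) = JI f - JI g := integral_sub hf.int hg.int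

lemma JI_smul (c : ℝ) (f : ℝ → ℝ) : JI (fun x => c * f x) = c * JI f :=
  integral_const_mul _ _

lemma JI_const (c : ℝ) : JI (fun _ => c) = c := by simp [JI]

lemma JI_mono {f g : ℝ → ℝ} (hf : BM f) (hg : BM g) (h : ∀ x, f x ≤ g x) : JI f ≤ JI g :=
  setIntegral_mono hf.int hg.int h

/-- Step functions on a uniform grid. -/
def Stp (f : ℝ → ℝ) : Prop := ∃ N : ℕ, 0 < N ∧ ∃ F : ℤ → ℝ, ∀ x, f x = F ⌊(N:ℝ) * x⌋

lemma Stp.refine {f : ℝ → ℝ} {N : ℕ} {F : ℤ → ℝ} (h : ∀ x, f x = F ⌊(N:ℝ) * x⌋) (K : ℕ)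
    (hK : 0 < K) : ∃ F' : ℤ → ℝ, ∀ x, f x = F' ⌊((N * K : ℕ):ℝ) * x⌋ := by
  refine ⟨fun z => F (z / K), fun x => ?_⟩
  rw [h x]
  congr 1
  have hK' : (0:ℝ) < K := by exact_mod_cast hK
  have := Int.floor_div_natCast (((N * K : ℕ):ℝ) * x) K
  rw [← this]
  congr 1
  push_cast
  field_simp

lemma Stp.op {f g : ℝ → ℝ} (hf : Stp f) (hg : Stp g) (o : ℝ → ℝ → ℝ) :
    Stp (fun x => o (f x) (g x)) := by
  obtain ⟨N, hN, F, hF⟩ := hf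
  obtain ⟨K, hK, G, hG⟩ := hg
  obtain ⟨F', hF'⟩ := Stp.refine hF K hK
  obtain ⟨G', hG'⟩ := Stp.refine hG N hN
  refine ⟨N * K, by positivity, fun z => o (F' z) (G' z), fun x => ?_⟩
  simp only [hF' x, hG' x, mul_comm K N]

lemma Stp.const (c : ℝ) : Stp (fun _ => c) := ⟨1, one_pos, fun _ => c, fun _ => rfl⟩

lemma Stp.meas {f : ℝ → ℝ} (hf : Stp f) : Measurable f := by
  obtain ⟨N, hN, F, hF⟩ := hf
  have : f = F ∘ (fun x : ℝ => ⌊(N:ℝ) * x⌋) := funext hF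
  rw [this]
  exact (measurable_from_top).comp (Int.measurable_floor.comp (measurable_const.mul measurable_id))

lemma Stp.pwc {f : ℝ → ℝ} (hf : Stp f) : PWC f := by
  obtain ⟨N, hN, F, hF⟩ := hf
  have hN' : (0:ℝ) < N := by exact_mod_cast hN
  refine ⟨N, fun j => (j:ℝ) / N, by simp, by field_simp, fun j _ => ?_, fun j _ x hx => ?_⟩
  · push_cast
    gcongr
    linarith
  · rw [hF, hF]
    congr 1
    have h1 : ⌊(N:ℝ) * ((j:ℝ) / N)⌋ = j := by
      rw [mul_div_cancel₀ _ hN'.ne']; simp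
    simp only at h1 ⊢
    rw [h1, Int.floor_eq_iff]
    obtain ⟨h2, h3⟩ := hx
    rw [div_le_iff₀ hN'] at h2
    rw [lt_div_iff₀ hN'] at h3
    push_cast at *
    constructor <;> linarith

/-- Approximation of a bounded measurable function by step functions. -/
lemma approx {r : ℝ → ℝ} (hr : Measurable r) (hb : ∀ x, |r x| ≤ 1) {η : ℝ} (hη : 0 < η) :
    ∃ α : ℝ → ℝ, Stp α ∧ (∀ x, |α x| ≤ 1) ∧ JI (fun x => |α x - r x|) ≤ η := by
  have hBr : BM r := ⟨hr, 1, hb⟩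
  obtain ⟨g, -, hg, hgc, hgi⟩ := Integrable.exists_hasCompactSupport_integral_sub_le
    (μ := volume.restrict (Set.Icc (0:ℝ) 1)) hBr.int (half_pos hη)
  set k : ℝ → ℝ := fun x => max (-1) (min 1 (g x)) with hk
  have hkc : Continuous k := by fun_prop
  have hkb : ∀ x, |k x| ≤ 1 := fun x => by
    rw [abs_le]; exact ⟨le_max_left _ _, max_le (by norm_num) (min_le_left _ _)⟩
  have hkr : ∀ x, |r x - k x| ≤ |r x - g x| := fun x => by
    have h1 := abs_le.1 (hb x)
    simp only [hk]
    rcases le_total (g x) 1 with h | h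
    · rw [min_eq_right h]
      rcases le_total (-1) (g x) with h' | h'
      · rw [max_eq_right h']
      · rw [max_eq_left h', abs_of_nonneg (by linarith), abs_of_nonneg (by linarith)]; linarith
    · rw [min_eq_left h, max_eq_right (by norm_num), abs_of_nonpos (by linarith),
        abs_of_nonpos (by linarith)]; linarith
  have huc : UniformContinuousOn k (Set.Icc (0:ℝ) 1) :=
    isCompact_Icc.uniformContinuousOn_of_continuous hkc.continuousOn
  rw [Metric.uniformContinuousOn_iff] at huc
  obtain ⟨d, hd, hdd⟩ := huc (η / 2) (half_pos hη)
  obtain ⟨n, hn⟩ := exists_nat_one_div_lt hd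
  set N : ℕ := n + 1 with hN
  have hN' : (0:ℝ) < N := by rw [hN]; positivity
  have hS : Stp (fun x => k ((⌊(N:ℝ) * x⌋ : ℤ) / (N:ℝ))) :=
    ⟨N, by omega, fun z => k ((z:ℝ) / N), fun x => rfl⟩
  refine ⟨_, hS, fun x => hkb _, ?_⟩
  have hBa : BM (fun x => k ((⌊(N:ℝ) * x⌋ : ℤ) / (N:ℝ))) := ⟨hS.meas, 1, fun x => hkb _⟩
  have hig : IntegrableOn (fun x => |r x - g x|) (Set.Icc (0:ℝ) 1) := (hBr.int.sub hgi).abs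
  have hlast : JI (fun x => |k ((⌊(N:ℝ) * x⌋ : ℤ) / (N:ℝ)) - r x|)
      ≤ ∫ x in Set.Icc (0:ℝ) 1, (η / 2 + |r x - g x|) := by
    refine setIntegral_mono_on (hBa.sub hBr).abs.int ?_ measurableSet_Icc ?_
    · exact (BM.const (η/2)).int.add hig
    · intro x hx
      have hx0 : 0 ≤ (N:ℝ) * x := mul_nonneg hN'.le hx.1
      have f1 := Int.floor_le ((N:ℝ) * x)
      have f2 := Int.lt_floor_add_one ((N:ℝ) * x)
      have f3 : (0:ℝ) ≤ (⌊(N:ℝ) * x⌋ : ℤ) := by exact_mod_cast Int.floor_nonneg.2 hx0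
      have hle : ((⌊(N:ℝ) * x⌋ : ℤ):ℝ) / N ≤ x := by rw [div_le_iff₀ hN']; linarith
      have hge : x - 1 / N < ((⌊(N:ℝ) * x⌋ : ℤ):ℝ) / N := by
        rw [lt_div_iff₀ hN', sub_mul, one_div, inv_mul_cancel₀ hN'.ne']; linarith
      have hdist := hdd _ (⟨by positivity, hle.trans hx.2⟩ :
        ((⌊(N:ℝ) * x⌋ : ℤ):ℝ) / N ∈ Set.Icc (0:ℝ) 1) x hx (by
          rw [Real.dist_eq, abs_of_nonpos (by linarith)]
          have : (1:ℝ) / N < d := by rw [hN]; push_cast; exact hn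
          linarith)
      rw [Real.dist_eq] at hdist
      have h5 := hkr x
      rw [abs_sub_comm] at h5
      have := abs_sub_le (k ((⌊(N:ℝ) * x⌋ : ℤ) / (N:ℝ))) (k x) (r x)
      linarith
  refine hlast.trans ?_
  rw [integral_add (BM.const (η/2)).int hig]
  have h6 : ∫ x in Set.Icc (0:ℝ) 1, |r x - g x| ≤ η / 2 := by simpa [Real.norm_eq_abs] using hg
  have h7 : ∫ x in Set.Icc (0:ℝ) 1, (η / 2 : ℝ) = η / 2 := by simp
  rw [h7]; linarith
set_option linter.unusedSimpArgs false
set_option maxHeartbeats 8000000 in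
lemma core (ε : ℝ) (hε : ε = 1 / 2000) (p q : (ℝ → ℝ) → (ℝ → ℝ) → ℝ → ℝ)
    (G : (ℝ → ℝ) → Prop) (hG : ∀ ψ, G ψ ↔ Stp ψ ∧ ∀ x, |ψ x| ≤ 2)
    (hp : ∀ f g, G f → G g → Measurable (p f g))
    (hq : ∀ f g, G f → G g → Measurable (q f g))
    (hp01 : ∀ f g x, p f g x = 0 ∨ p f g x = 1)
    (hq01 : ∀ f g x, q f g x = 0 ∨ q f g x = 1)
    (hpq : ∀ f g x, G f → G g → p f g x + q f g x ≤ 1)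
    (pr1 : ∀ f g, G f → G g →
      1 / 2 + ε / 2 * JI f ≤ JI (p f g) + ε * JI (fun x => f x * p f g x))
    (pr2 : ∀ f g, G f → G g →
      1 / 2 + ε / 2 * JI g ≤ JI (q f g) + ε * JI (fun x => g x * q f g x))
    (tr1 : ∀ f f' g, G f → G f' → G g →
      JI (p f' g) + ε * JI (fun x => f x * p f' g x)
        ≤ JI (p f g) + ε * JI (fun x => f x * p f g x))
    (tr2 : ∀ f g g', G f → G g → G g' →
      JI (q f g') + ε * JI (fun x => g x * q f g' x)
        ≤ JI (q f g) + ε * JI (fun x => g x * q f g x)) : False := by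
  have hε0 : 0 < ε := by rw [hε]; norm_num
  have Bp : ∀ f g, G f → G g → BM (p f g) := fun f g hf hg =>
    ⟨hp f g hf hg, 1, fun x => by rcases hp01 f g x with h | h <;> rw [h] <;> simp⟩
  have Bq : ∀ f g, G f → G g → BM (q f g) := fun f g hf hg =>
    ⟨hq f g hf hg, 1, fun x => by rcases hq01 f g x with h | h <;> rw [h] <;> simp⟩
  have BG : ∀ f, G f → BM f := fun f hf => ⟨((hG f).1 hf).1.meas, 2, ((hG f).1 hf).2⟩
  have G0 : G (fun _ => 0) := (hG _).2 ⟨Stp.const 0, fun x => by simp⟩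
  -- the base profile
  obtain ⟨a, ha⟩ : ∃ a, a = p (fun _ => 0) (fun _ => 0) := ⟨_, rfl⟩
  obtain ⟨b, hb⟩ : ∃ b, b = q (fun _ => 0) (fun _ => 0) := ⟨_, rfl⟩
  have Ba : BM a := ha ▸ Bp _ _ G0 G0
  have Bb : BM b := hb ▸ Bq _ _ G0 G0
  have ha01 : ∀ x, a x = 0 ∨ a x = 1 := ha ▸ hp01 _ _
  have hb01 : ∀ x, b x = 0 ∨ b x = 1 := hb ▸ hq01 _ _
  have hab : ∀ x, a x + b x ≤ 1 := fun x => by rw [ha, hb]; exact hpq _ _ x G0 G0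
  have Ja1 : 1 / 2 ≤ JI a := by
    have := pr1 _ _ G0 G0
    rw [← ha] at this
    simpa [JI_const] using this
  have Jb1 : 1 / 2 ≤ JI b := by
    have := pr2 _ _ G0 G0
    rw [← hb] at this
    simpa [JI_const] using this
  have Jab : JI a + JI b ≤ 1 := by
    rw [← JI_add Ba Bb]
    exact (JI_mono (Ba.add Bb) (BM.const 1) hab).trans (JI_const 1).le
  have Ja : JI a = 1 / 2 := by linarith
  have Jb : JI b = 1 / 2 := by linarith
  obtain ⟨α, Sα, hα, eα⟩ := approx (r := fun x => 1 - 2 * b x)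
    ((BM.const 1).sub ((BM.const 2).mul Bb)).1
    (fun x => by rcases hb01 x with h | h <;> rw [h] <;> norm_num) (η := 1 / 1000) (by norm_num)
  have Gα : G α := (hG _).2 ⟨Sα, fun x => (hα x).trans (by norm_num)⟩
  have Gα2 : G (fun x => α x / 2) := (hG _).2 ⟨Sα.op Sα (fun u _ => u / 2), fun x => by
    have := abs_le.1 (hα x); rw [abs_le]; constructor <;> linarith⟩
  obtain ⟨c, hc⟩ : ∃ c, c = q α (fun x => α x / 2) := ⟨_, rfl⟩
  have Bc : BM c := hc ▸ Bq _ _ Gα Gα2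
  have hc01 : ∀ x, c x = 0 ∨ c x = 1 := hc ▸ hq01 _ _
  obtain ⟨β, Sβ, hβ, eβ⟩ := approx (r := fun x => 1 - 2 * c x)
    ((BM.const 1).sub ((BM.const 2).mul Bc)).1
    (fun x => by rcases hc01 x with h | h <;> rw [h] <;> norm_num) (η := 1 / 1000) (by norm_num)
  have Bα : BM α := BG _ Gα
  have Bβ : BM β := ⟨Sβ.meas, 1, hβ⟩
  -- errors
  obtain ⟨e, he⟩ : ∃ e : ℝ → ℝ, e = fun x => |α x - (1 - 2 * b x)| := ⟨_, rfl⟩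
  obtain ⟨e', he'⟩ : ∃ e : ℝ → ℝ, e = fun x => |β x - (1 - 2 * c x)| := ⟨_, rfl⟩
  have Be : BM e := he ▸ (Bα.sub ((BM.const 1).sub ((BM.const 2).mul Bb))).abs
  have Be' : BM e' := he' ▸ (Bβ.sub ((BM.const 1).sub ((BM.const 2).mul Bc))).abs
  rw [← he] at eα
  rw [← he'] at eβ
  have he1 : ∀ x, α x - (1 - 2 * b x) ≤ e x ∧ -(α x - (1 - 2 * b x)) ≤ e x := fun x => by
    rw [he]; exact ⟨le_abs_self _, neg_le_abs _⟩
  have he1' : ∀ x, β x - (1 - 2 * c x) ≤ e' x ∧ -(β x - (1 - 2 * c x)) ≤ e' x := fun x => by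
    rw [he']; exact ⟨le_abs_self _, neg_le_abs _⟩
  -- the line
  obtain ⟨δ, hδ⟩ : ∃ δ : ℝ → ℝ, δ = fun x => 3 / 2 * α x + 3 / 8 * β x := ⟨_, rfl⟩
  obtain ⟨φ, hφ⟩ : ∃ φ : ℝ → ℝ → ℝ, φ = fun t x => (-α x - β x / 2) + t * δ x := ⟨_, rfl⟩
  obtain ⟨γ, hγ⟩ : ∃ γ : ℝ → ℝ, γ = fun x => α x / 2 - β x / 8 := ⟨_, rfl⟩
  have hφ1 : φ 1 = γ := by rw [hφ, hγ, hδ]; funext x; ring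
  have Bδ : BM δ := hδ ▸ ((BM.const _).mul Bα).add ((BM.const _).mul Bβ)
  have hδ2 : ∀ x, |δ x| ≤ 2 := fun x => by
    have h1 := abs_le.1 (hα x); have h2 := abs_le.1 (hβ x)
    rw [hδ, abs_le]; constructor <;> dsimp only <;> linarith
  have Gφ : ∀ t, 0 ≤ t → t ≤ 1 → G (φ t) := fun t h0 h1 => by
    rw [hG]
    constructor
    · have := Sα.op Sβ (fun u v => (-u - v / 2) + t * (3 / 2 * u + 3 / 8 * v))
      rw [hφ, hδ]; exact this
    · intro x
      have h3 := abs_le.1 (hα x); have h4 := abs_le.1 (hβ x)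
      have : φ t x = (1 - t) * (-α x - β x / 2) + t * (α x / 2 - β x / 8) := by
        rw [hφ, hδ]; ring
      rw [this, abs_le]
      constructor
      · nlinarith
      · nlinarith
  have Gγ : G γ := hφ1 ▸ Gφ 1 (by norm_num) le_rfl
  have G00 : G (φ 0) := Gφ 0 le_rfl (by norm_num)
  have Bγ := BG _ Gγ
  have Bφ0 := BG _ G00
  have hφ0 : ∀ x, φ 0 x = -α x - β x / 2 := fun x => by rw [hφ]; ring
  -- K = J(b ρ)
  obtain ⟨K, hK⟩ : ∃ K, K = JI (fun x => b x * (1 - 2 * c x)) := ⟨_, rfl⟩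
  have BK : BM (fun x => b x * (1 - 2 * c x)) := Bb.mul ((BM.const 1).sub ((BM.const 2).mul Bc))
  -- Step (i)
  have step1 : JI (q α (φ 0)) + ε * JI (fun x => φ 0 x * q α (φ 0) x)
      ≤ 1 / 2 + ε / 2 + ε * (-K / 2 + 95 / 10000) := by
    have Bp1 := Bp _ _ G0 G00
    have Bq1 := Bq _ _ G0 G00
    have hp1 := hp01 (fun _ => 0) (φ 0)
    have hq1 := hq01 (fun _ => 0) (φ 0)
    have hpq1 := fun x => hpq (fun _ => 0) (φ 0) x G0 G00
    have t1 := tr2 _ _ _ G0 G00 G0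
    have t2 := pr1 _ _ G0 G00
    have t3 := tr1 _ _ _ Gα G0 G00
    rw [← hb] at t1
    simp only [zero_mul, mul_zero, add_zero, JI_const] at t2
    generalize p (fun _ => 0) (φ 0) = p1 at *
    generalize q (fun _ => 0) (φ 0) = q1 at *
    have Bp2 := Bp _ _ Gα G00
    have Bq2 := Bq _ _ Gα G00
    have hp2 := hp01 α (φ 0)
    have hq2 := hq01 α (φ 0)
    have hpq2 := fun x => hpq α (φ 0) x Gα G00
    generalize p α (φ 0) = p2 at *
    generalize q α (φ 0) = q2 at *
    have i0 : JI (fun x => p1 x + q1 x) ≤ JI (fun _ => 1) :=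
      JI_mono (Bp1.add Bq1) (BM.const 1) hpq1
    have i1 : JI (fun x => b x - q1 x * b x) ≤
        JI (fun x => 2 * (φ 0 x * b x) - 2 * (φ 0 x * q1 x) + 2 * e x + e' x) := by
      refine JI_mono (by simp (config := { maxDischargeDepth := 12 }) only [BM.add, BM.sub, BM.mul, BM.const, Ba, Bb, Bc, Be, Be', Bα, Bβ, Bγ, Bδ, Bφ0, BK, Bq1, true_and]) (by simp (config := { maxDischargeDepth := 12 }) only [BM.add, BM.sub, BM.mul, BM.const, Ba, Bb, Bc, Be, Be', Bα, Bβ, Bγ, Bδ, Bφ0, BK, Bq1]) fun x => ?_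
      have h1 := he1 x
      have h2 := he1' x
      rw [hφ0 x]
      rcases hq1 x with h | h <;> rcases hb01 x with h' | h' <;> rcases hc01 x with h'' | h'' <;>
        rw [h, h'] <;> rw [h'] at h1 <;> rw [h''] at h2 <;> linarith [h1.1, h1.2, h2.1, h2.2]
    have i2 : JI (fun x => p1 x - 2 * (b x - q1 x * b x) - e x) ≤ JI (fun x => α x * p1 x) := by
      refine JI_mono (by simp (config := { maxDischargeDepth := 12 }) only [BM.add, BM.sub, BM.mul, BM.const, Ba, Bb, Bc, Be, Be', Bα, Bβ, Bγ, Bδ, Bφ0, BK, Bq1, Bp1]) (Bα.mul Bp1) fun x => ?_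
      have h1 := he1 x
      have h3 := hpq1 x
      rcases hq1 x with h | h <;> rcases hb01 x with h' | h' <;> rcases hp1 x with h'' | h'' <;>
        rw [h, h', h''] <;> rw [h'] at h1 <;> rw [h, h''] at h3 <;> linarith [h1.1, h1.2]
    have i3 : JI (fun x => p2 x + q2 x) ≤ JI (fun _ => 1) :=
      JI_mono (Bp2.add Bq2) (BM.const 1) hpq2
    have i4 : JI (fun x => α x * p2 x + φ 0 x * q2 x) ≤
        JI (fun x => 1 - 1 / 2 * (b x * (1 - 2 * c x)) + 2 * e x + 1 / 2 * e' x) := by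
      refine JI_mono ((Bα.mul Bp2).add (Bφ0.mul Bq2)) (by simp (config := { maxDischargeDepth := 12 }) only [BM.add, BM.sub, BM.mul, BM.const, Ba, Bb, Bc, Be, Be', Bα, Bβ, Bγ, Bδ, Bφ0, BK, Bq1]) fun x => ?_
      have h1 := he1 x
      have h2 := he1' x
      have h3 := hpq2 x
      rw [hφ0 x]
      rcases hq2 x with h | h <;> rcases hb01 x with h' | h' <;> rcases hc01 x with h'' | h'' <;>
        rcases hp2 x with h4 | h4 <;>
        rw [h, h', h'', h4] <;> rw [h'] at h1 <;> rw [h''] at h2 <;> rw [h, h4] at h3 <;>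
        linarith [h1.1, h1.2, h2.1, h2.2]
    simp (config := { maxDischargeDepth := 12 }) only [JI_add, JI_sub, JI_smul, JI_const, BM.add, BM.sub, BM.mul, BM.const, Ba, Bb, Bc, Be, Be', Bα, Bβ, Bγ, Bδ, Bφ0, BK, Bp1, Bq1, Bp2, Bq2] at i0 i1 i2 i3
    rw [JI_add (Bα.mul Bp2) (Bφ0.mul Bq2), JI_add (by simp (config := { maxDischargeDepth := 12 }) only [BM.add, BM.sub, BM.mul, BM.const, Ba, Bb, Bc, Be, Be', Bα, Bβ, Bγ, Bδ, Bφ0, BK, Bq1]) ((BM.const _).mul Be'), JI_add (by simp (config := { maxDischargeDepth := 12 }) only [BM.add, BM.sub, BM.mul, BM.const, Ba, Bb, Bc, Be, Be', Bα, Bβ, Bγ, Bδ, Bφ0, BK, Bq1]) ((BM.const _).mul Be), JI_sub (BM.const _) ((BM.const _).mul BK), JI_smul, JI_smul, JI_smul, JI_const, ← hK] at i4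
    have j1 : JI (fun x => φ 0 x * b x) ≤ JI (fun x => φ 0 x * q1 x) := by
      by_contra hcon
      push Not at hcon
      nlinarith
    have j2 : 1 / 2 - 7 / 1000 ≤ JI (fun x => α x * p1 x) := by linarith
    rw [hε] at *
    linarith
  have step2 : 1 / 2 + ε / 2 + ε * (-K / 2 - 75 / 10000)
      ≤ JI (q γ (φ 0)) + ε * JI (fun x => φ 0 x * q γ (φ 0) x) := by
    have Bp1 := Bp _ _ Gγ G0
    have Bq1 := Bq _ _ Gγ G0
    have hp1 := hp01 γ (fun _ => 0)
    have hq1 := hq01 γ (fun _ => 0)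
    have hpq1 := fun x => hpq γ (fun _ => 0) x Gγ G0
    have t1 := tr1 _ _ _ Gγ G0 G0
    have t2 := pr2 _ _ Gγ G0
    have t3 := tr2 _ _ _ Gγ G00 G0
    rw [← ha] at t1
    simp only [zero_mul, mul_zero, add_zero, JI_const] at t2
    generalize p γ (fun _ => 0) = p1 at *
    generalize q γ (fun _ => 0) = q1 at *
    have i0 : JI (fun x => p1 x + q1 x) ≤ JI (fun _ => 1) :=
      JI_mono (Bp1.add Bq1) (BM.const 1) hpq1
    have i1 : JI (fun x => 3 / 8 * (1 - b x - p1 x + 2 * (b x * p1 x))) ≤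
        JI (fun x => γ x * a x - γ x * p1 x + (1 - a x - b x) + 1 / 2 * e x + 1 / 8 * e' x) := by
      refine JI_mono (by simp (config := { maxDischargeDepth := 12 }) only [BM.add, BM.sub, BM.mul, BM.const, Ba, Bb, Bc, Be, Be', Bα, Bβ, Bγ, Bδ, Bφ0, BK, Bp1]) (by simp (config := { maxDischargeDepth := 12 }) only [BM.add, BM.sub, BM.mul, BM.const, Ba, Bb, Bc, Be, Be', Bα, Bβ, Bγ, Bδ, Bφ0, BK, Bp1]) fun x => ?_
      have h1 := he1 x
      have h2 := he1' x
      have h3 := hab x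
      have h5 := abs_le.1 (hα x)
      have h6 := abs_le.1 (hβ x)
      rw [hγ]
      dsimp only
      rcases hp1 x with h | h <;> rcases hb01 x with h' | h' <;> rcases hc01 x with h'' | h'' <;>
        rcases ha01 x with h4 | h4 <;>
        rw [h, h', h4] <;> rw [h'] at h1 <;> rw [h''] at h2 <;> rw [h', h4] at h3 <;>
        linarith [h1.1, h1.2, h2.1, h2.2, h5.1, h5.2, h6.1, h6.2]
    have i2 : JI (fun x => b x - 1 / 2 * (b x * (1 - 2 * c x)) - 3 / 2 * (b x - q1 x)
        - 3 * (1 - b x - p1 x + 2 * (b x * p1 x)) - e x - 1 / 2 * e' x) ≤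
        JI (fun x => φ 0 x * q1 x) := by
      refine JI_mono (by simp (config := { maxDischargeDepth := 12 }) only [BM.add, BM.sub, BM.mul, BM.const, Ba, Bb, Bc, Be, Be', Bα, Bβ, Bγ, Bδ, Bφ0, BK, Bp1, Bq1]) (Bφ0.mul Bq1) fun x => ?_
      have h1 := he1 x
      have h2 := he1' x
      have h3 := hpq1 x
      rw [hφ0 x]
      rcases hp1 x with h | h <;> rcases hb01 x with h' | h' <;> rcases hc01 x with h'' | h'' <;>
        rcases hq1 x with h4 | h4 <;>
        rw [h, h', h'', h4] <;> rw [h'] at h1 <;> rw [h''] at h2 <;> rw [h, h4] at h3 <;>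
        linarith [h1.1, h1.2, h2.1, h2.2]
    obtain ⟨k, hk⟩ : ∃ k : ℝ → ℝ, k = fun x => b x * (1 - 2 * c x) := ⟨_, rfl⟩
    have hkx : ∀ x, b x * (1 - 2 * c x) = k x := fun x => by rw [hk]
    rw [← hk] at hK BK
    simp only [hkx] at i2
    simp (config := { maxDischargeDepth := 12 }) only [JI_add, JI_sub, JI_smul, JI_const, BM.add, BM.sub, BM.mul, BM.const, Ba, Bb, Bc, Be, Be', Bα, Bβ, Bγ, Bδ, Bφ0, BK, Bp1, Bq1] at i0 i1 i2
    rw [← hK] at i2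
    have j1 : JI (fun x => γ x * a x) ≤ JI (fun x => γ x * p1 x) := by
      by_contra hcon
      push Not at hcon
      nlinarith
    have j2 : 1 / 2 - K / 2 - 65 / 10000 ≤ JI (fun x => φ 0 x * q1 x) := by linarith
    rw [hε] at *
    linarith
  have step3 : 1 / 2 + ε / 2 * JI γ + ε * (999 / 1000) / 16
      ≤ JI (q α γ) + ε * JI (fun x => γ x * q α γ x) := by
    have t1 := tr2 _ _ _ Gα Gγ Gα2
    have t2 := pr2 _ _ Gα Gα2
    rw [← hc] at t1 t2
    have i1 : JI (fun x => 1 - e' x) ≤ JI (fun x => β x - 2 * (β x * c x)) := by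
      refine JI_mono ((BM.const 1).sub Be') (Bβ.sub ((BM.const 2).mul (Bβ.mul Bc))) fun x => ?_
      have h2 := he1' x
      rcases hc01 x with h'' | h'' <;> rw [h''] at h2 ⊢ <;> linarith [h2.1, h2.2]
    have e1 : JI (fun x => γ x * c x) =
        JI (fun x => α x / 2 * c x) - 1 / 8 * JI (fun x => β x * c x) := by
      rw [← JI_smul, ← JI_sub ((BG _ Gα2).mul Bc) ((BM.const _).mul (Bβ.mul Bc)), hγ]
      congr 1; funext x; ring
    have e2 : JI γ = JI (fun x => α x / 2) - 1 / 8 * JI β := by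
      rw [← JI_smul, ← JI_sub (BG _ Gα2) ((BM.const _).mul Bβ), hγ]
      congr 1; funext x; ring
    simp (config := { maxDischargeDepth := 12 }) only [JI_add, JI_sub, JI_smul, JI_const, BM.add, BM.sub, BM.mul, BM.const, Ba, Bb, Bc, Be, Be', Bα, Bβ, Bγ, Bδ, Bφ0, BK, Bγ] at i1
    rw [hε] at *
    rw [e1] at t1
    rw [e2]
    linarith
  have step4 : JI (q γ γ) + ε * JI (fun x => γ x * q γ γ x) ≤ 1 / 2 + ε / 2 * JI γ := by
    have t1 := pr1 _ _ Gγ Gγ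
    have Bp1 := Bp _ _ Gγ Gγ
    have Bq1 := Bq _ _ Gγ Gγ
    have i1 : JI (fun x => p γ γ x + q γ γ x + ε * (γ x * p γ γ x + γ x * q γ γ x))
        ≤ JI (fun x => 1 + ε * γ x) := by
      refine JI_mono ((Bp1.add Bq1).add ((BM.const _).mul ((Bγ.mul Bp1).add (Bγ.mul Bq1))))
        ((BM.const 1).add ((BM.const _).mul Bγ)) fun x => ?_
      have h1 := hpq γ γ x Gγ Gγ
      have h2 := abs_le.1 (((hG _).1 Gγ).2 x)
      have h3 : 0 ≤ 1 + ε * γ x := by rw [hε]; linarith [h2.1]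
      nlinarith
    rw [JI_add (Bp1.add Bq1) ((BM.const _).mul ((Bγ.mul Bp1).add (Bγ.mul Bq1))),
      JI_add Bp1 Bq1, JI_smul, JI_add (Bγ.mul Bp1) (Bγ.mul Bq1),
      JI_add (BM.const 1) ((BM.const _).mul Bγ), JI_smul, JI_const] at i1
    linarith
  have mono : ∀ t, 0 ≤ t → t ≤ 1 → JI (fun x => δ x * q α (φ t) x)
      ≤ JI (fun x => δ x * q γ (φ t) x) + 24 * ε := by
    intro t h0 h1
    have Gt := Gφ t h0 h1
    have t1 := tr1 _ _ _ Gα Gγ Gt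
    have t2 := tr1 _ _ _ Gγ Gα Gt
    have eδ : ∀ f, BM f → JI (fun x => δ x * f x) =
        3 * JI (fun x => α x * f x) - 3 * JI (fun x => γ x * f x) := fun f hf => by
      rw [← JI_smul, ← JI_smul, ← JI_sub ((BM.const _).mul (Bα.mul hf))
        ((BM.const _).mul (Bγ.mul hf)), hδ, hγ]
      congr 1; funext x; ring
    have hm : JI (fun x => δ x * p γ (φ t) x) ≤ JI (fun x => δ x * p α (φ t) x) := by
      rw [eδ _ (Bp _ _ Gγ Gt), eδ _ (Bp _ _ Gα Gt)]
      by_contra hcon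
      push Not at hcon
      nlinarith
    have bnd : ∀ f g, BM f → BM g → (∀ x, |f x| ≤ 2) → (∀ x, g x = 0 ∨ g x = 1) →
        JI (fun x => f x * g x) ≤ 2 := by
      intro f g hf hg hf2 hg2
      rw [← JI_const 2]
      refine JI_mono (hf.mul hg) (BM.const 2) fun x => ?_
      have := abs_le.1 (hf2 x)
      rcases hg2 x with h | h <;> rw [h] <;> linarith [this.2]
    have bnd2 : ∀ f, G f → -2 ≤ JI f := by
      intro f hf
      rw [← JI_const (-2)]
      exact JI_mono (BM.const (-2)) (BG _ hf) fun x => (abs_le.1 (((hG _).1 hf).2 x)).1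
    have waste : ∀ s, G s → |JI (fun x => δ x * q s (φ t) x) + JI (fun x => δ x * p s (φ t) x)
        - JI δ| ≤ 12 * ε := by
      intro s hs
      have Bp1 := Bp _ _ hs Gt
      have Bq1 := Bq _ _ hs Gt
      have r1 := pr1 _ _ hs Gt
      have r2 := pr2 _ _ hs Gt
      have r3 := bnd _ _ (BG _ hs) Bp1 ((hG _).1 hs).2 (hp01 _ _)
      have r4 := bnd _ _ (BG _ Gt) Bq1 ((hG _).1 Gt).2 (hq01 _ _)
      have r5 := bnd2 _ hs
      have r6 := bnd2 _ Gt
      have hpq1 := fun x => hpq s (φ t) x hs Gt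
      generalize p s (φ t) = p1 at *
      generalize q s (φ t) = q1 at *
      have w : 1 - JI p1 - JI q1 ≤ 6 * ε := by nlinarith
      have i1 : JI (fun x => δ x * q1 x + δ x * p1 x - δ x) ≤ JI (fun x => 2 * (1 - p1 x - q1 x)) := by
        refine JI_mono (((Bδ.mul Bq1).add (Bδ.mul Bp1)).sub Bδ)
          ((BM.const 2).mul (((BM.const 1).sub Bp1).sub Bq1)) fun x => ?_
        have := abs_le.1 (hδ2 x)
        nlinarith [hpq1 x, this.1, this.2]
      have i2 : JI (fun x => (-2) * (1 - p1 x - q1 x)) ≤ JI (fun x => δ x * q1 x + δ x * p1 x - δ x) := by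
        refine JI_mono ((BM.const (-2)).mul (((BM.const 1).sub Bp1).sub Bq1))
          (((Bδ.mul Bq1).add (Bδ.mul Bp1)).sub Bδ) fun x => ?_
        have := abs_le.1 (hδ2 x)
        nlinarith [hpq1 x, this.1, this.2]
      rw [JI_sub ((Bδ.mul Bq1).add (Bδ.mul Bp1)) Bδ, JI_add (Bδ.mul Bq1) (Bδ.mul Bp1), JI_smul,
        JI_sub ((BM.const 1).sub Bp1) Bq1, JI_sub (BM.const 1) Bp1, JI_const] at i1 i2
      rw [abs_le]
      constructor <;> linarith
    have w1 := abs_le.1 (waste _ Gα)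
    have w2 := abs_le.1 (waste _ Gγ)
    linarith [w1.1, w1.2, w2.1, w2.2]
  -- v_s(t)
  have chain : ∀ n : ℕ, n ≤ 1000 →
      (JI (q α (φ (n / 1000))) + ε * JI (fun x => φ (n / 1000) x * q α (φ (n / 1000)) x))
      - (JI (q γ (φ (n / 1000))) + ε * JI (fun x => φ (n / 1000) x * q γ (φ (n / 1000)) x))
      ≤ (JI (q α (φ 0)) + ε * JI (fun x => φ 0 x * q α (φ 0) x))
      - (JI (q γ (φ 0)) + ε * JI (fun x => φ 0 x * q γ (φ 0) x))
      + ε / 1000 * (JI (fun x => δ x * q γ (φ (n / 1000)) x) - JI (fun x => δ x * q γ (φ 0) x))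
      + n / 1000 * (24 * ε ^ 2) := by
    intro n
    induction n with
    | zero => intro _; simp
    | succ n ih =>
      intro hn
      have ih := ih (by omega)
      have hnr : (n:ℝ) + 1 ≤ 1000 := by exact_mod_cast hn
      have hn0 : (0:ℝ) ≤ n := Nat.cast_nonneg n
      have ht : ((n + 1 : ℕ) : ℝ) / 1000 = n / 1000 + 1 / 1000 := by push_cast; ring
      have hn2 : ((n + 1 : ℕ) : ℝ) / 1000 * (24 * ε ^ 2)
          = n / 1000 * (24 * ε ^ 2) + 24 * ε ^ 2 / 1000 := by push_cast; ring
      rw [hn2, ht]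
      generalize ht0 : (n:ℝ) / 1000 = t at *
      have h0 : 0 ≤ t := by rw [← ht0]; positivity
      have h1 : t + 1 / 1000 ≤ 1 := by rw [← ht0]; linarith
      have Gt := Gφ t h0 (by linarith)
      have Gt' := Gφ (t + 1 / 1000) (by linarith) h1
      have m := mono (t + 1 / 1000) (by linarith) h1
      have t1 := tr2 _ _ _ Gα Gt Gt'
      have t2 := tr2 _ _ _ Gγ Gt' Gt
      have ex : ∀ f, BM f → JI (fun x => φ (t + 1 / 1000) x * f x) =
          JI (fun x => φ t x * f x) + 1 / 1000 * JI (fun x => δ x * f x) := fun f hf => by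
        rw [← JI_smul, ← JI_add ((BG _ Gt).mul hf) ((BM.const _).mul (Bδ.mul hf)), hφ]
        congr 1; funext x; ring
      rw [ex _ (Bq _ _ Gγ Gt)] at t2
      rw [ex _ (Bq _ _ Gα Gt')]
      have m' := mul_le_mul_of_nonneg_left m hε0.le
      nlinarith
  have fin := chain 1000 le_rfl
  have h1000 : ((1000 : ℕ) : ℝ) / 1000 = 1 := by norm_num
  rw [h1000, hφ1] at fin
  have bd : ∀ g, G g → JI (fun x => δ x * q γ g x) ≤ 2 ∧ -2 ≤ JI (fun x => δ x * q γ g x) := by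
    intro g hg
    have hh : ∀ x, |δ x * q γ g x| ≤ 2 := fun x => by
      rcases hq01 γ g x with h | h <;> rw [h] <;> simp [hδ2 x]
    have hB := Bδ.mul (Bq _ _ Gγ hg)
    constructor
    · rw [← JI_const 2]
      exact JI_mono hB (BM.const 2) fun x => (abs_le.1 (hh x)).2
    · rw [← JI_const (-2)]
      exact JI_mono (BM.const (-2)) hB fun x => (abs_le.1 (hh x)).1
  have b1 := (bd _ Gγ).1
  have b2 := (bd _ G00).2
  rw [hε] at *
  linarith

/-- 0/1-valued indicator. -/
noncomputable def ind (X : Set ℝ) : ℝ → ℝ := X.indicator (fun _ => 1)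

lemma val_eq {f : ℝ → ℝ} {X : Set ℝ} (hX : MeasurableSet X) (hXI : X ⊆ Set.Icc 0 1) :
    val f X = JI (fun x => f x * ind X x) := by
  have : (fun x => f x * ind X x) = X.indicator f := by
    funext x; by_cases h : x ∈ X <;> simp [ind, h]
  rw [this, JI, setIntegral_indicator hX, inter_eq_self_of_subset_right hXI, val]

lemma ind01 (X : Set ℝ) (x : ℝ) : ind X x = 0 ∨ ind X x = 1 := by
  by_cases h : x ∈ X <;> simp [ind, h]

lemma ind_meas {X : Set ℝ} (hX : MeasurableSet X) : Measurable (ind X) :=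
  measurable_const.indicator hX

lemma val_T {ψ : ℝ → ℝ} (hψ : BM ψ) (ε : ℝ) {X : Set ℝ} (hX : MeasurableSet X)
    (hXI : X ⊆ Set.Icc 0 1) : val (fun x => 1 + ε * ψ x) X
      = JI (ind X) + ε * JI (fun x => ψ x * ind X x) := by
  have hB : BM (ind X) := ⟨ind_meas hX, 1, fun x => by rcases ind01 X x with h | h <;> simp [h]⟩
  rw [val_eq hX hXI, ← JI_smul, ← JI_add hB ((BM.const _).mul (hψ.mul hB))]
  congr 1; funext x; ring

lemma val_T_all {ψ : ℝ → ℝ} (hψ : BM ψ) (ε : ℝ) : 1 / 2 * val (fun x => 1 + ε * ψ x) (Set.Icc 0 1)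
      = 1 / 2 + ε / 2 * JI ψ := by
  have : val (fun x => 1 + ε * ψ x) (Set.Icc 0 1) = JI (fun x => 1 + ε * ψ x) := rfl
  rw [this, JI_add (BM.const 1) ((BM.const _).mul hψ), JI_smul, JI_const]
  ring

/-- There is no deterministic, truthful, proportional two-agent cake-cutting mechanism,
even for piecewise-constant, everywhere-positive densities, and even if part of the cake
may be left unallocated. -/
theorem no_truthful_proportional_mechanism :
    ¬ ∃ M : (ℝ → ℝ) → (ℝ → ℝ) → Set ℝ × Set ℝ,
      (∀ f₁ f₂, ValidPC f₁ → ValidPC f₂ →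
        MeasurableSet (M f₁ f₂).1 ∧ MeasurableSet (M f₁ f₂).2 ∧
        (M f₁ f₂).1 ⊆ Set.Icc 0 1 ∧ (M f₁ f₂).2 ⊆ Set.Icc 0 1 ∧
        Disjoint (M f₁ f₂).1 (M f₁ f₂).2) ∧
      -- proportionality
      (∀ f₁ f₂, ValidPC f₁ → ValidPC f₂ →
        val f₁ (M f₁ f₂).1 ≥ (1/2) * val f₁ (Set.Icc 0 1) ∧
        val f₂ (M f₁ f₂).2 ≥ (1/2) * val f₂ (Set.Icc 0 1)) ∧
      -- truthfulness for agent 1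
      (∀ f₁ f₁' f₂, ValidPC f₁ → ValidPC f₁' → ValidPC f₂ →
        val f₁ (M f₁ f₂).1 ≥ val f₁ (M f₁' f₂).1) ∧
      -- truthfulness for agent 2
      (∀ f₁ f₂ f₂', ValidPC f₁ → ValidPC f₂ → ValidPC f₂' →
        val f₂ (M f₁ f₂).2 ≥ val f₂ (M f₁ f₂').2) := by
  rintro ⟨M, hM, hpr, ht1, ht2⟩
  have val_ok : ∀ ψ : ℝ → ℝ, (Stp ψ ∧ ∀ x, |ψ x| ≤ 2) →
      ValidPC (fun x => 1 + (1 / 2000 : ℝ) * ψ x) := by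
    rintro ψ ⟨h1, h2⟩
    have h3 : ∀ x, 0 < 1 + (1 / 2000 : ℝ) * ψ x := fun x => by
      have := abs_le.1 (h2 x); linarith [this.1]
    exact ⟨(h1.op h1 (fun u _ => 1 + (1 / 2000 : ℝ) * u)).pwc, fun x _ => h3 x, fun x => (h3 x).le⟩
  have bm_ok : ∀ ψ : ℝ → ℝ, (Stp ψ ∧ ∀ x, |ψ x| ≤ 2) → BM ψ :=
    fun ψ h => ⟨h.1.meas, 2, h.2⟩
  refine core (1 / 2000) rfl
    (fun f g => ind (M (fun x => 1 + (1 / 2000 : ℝ) * f x) (fun x => 1 + (1 / 2000 : ℝ) * g x)).1)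
    (fun f g => ind (M (fun x => 1 + (1 / 2000 : ℝ) * f x) (fun x => 1 + (1 / 2000 : ℝ) * g x)).2)
    (fun ψ => Stp ψ ∧ ∀ x, |ψ x| ≤ 2) (fun _ => Iff.rfl) ?_ ?_ (fun _ _ _ => ind01 _ _)
    (fun _ _ _ => ind01 _ _) ?_ ?_ ?_ ?_ ?_
  · intro f g hf hg
    exact ind_meas (hM _ _ (val_ok f hf) (val_ok g hg)).1
  · intro f g hf hg
    exact ind_meas (hM _ _ (val_ok f hf) (val_ok g hg)).2.1
  · intro f g x hf hg
    have hd := (hM _ _ (val_ok f hf) (val_ok g hg)).2.2.2.2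
    simp only [ind]
    by_cases h1 : x ∈ (M (fun x => 1 + (1 / 2000 : ℝ) * f x) (fun x => 1 + (1 / 2000 : ℝ) * g x)).1
    · have h2 := Set.disjoint_left.1 hd h1
      rw [Set.indicator_of_mem h1, Set.indicator_of_notMem h2]; norm_num
    · rw [Set.indicator_of_notMem h1, zero_add]
      exact Set.indicator_le_self' (fun _ _ => zero_le_one) x
  · intro f g hf hg
    have h := hM _ _ (val_ok f hf) (val_ok g hg)
    have h2 := (hpr _ _ (val_ok f hf) (val_ok g hg)).1
    rw [val_T_all (bm_ok f hf), val_T (bm_ok f hf) _ h.1 h.2.2.1] at h2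
    exact h2
  · intro f g hf hg
    have h := hM _ _ (val_ok f hf) (val_ok g hg)
    have h2 := (hpr _ _ (val_ok f hf) (val_ok g hg)).2
    rw [val_T_all (bm_ok g hg), val_T (bm_ok g hg) _ h.2.1 h.2.2.2.1] at h2
    exact h2
  · intro f f' g hf hf' hg
    have h := hM _ _ (val_ok f hf) (val_ok g hg)
    have h' := hM _ _ (val_ok f' hf') (val_ok g hg)
    have h2 := ht1 _ _ _ (val_ok f hf) (val_ok f' hf') (val_ok g hg)
    rw [val_T (bm_ok f hf) _ h.1 h.2.2.1, val_T (bm_ok f hf) _ h'.1 h'.2.2.1] at h2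
    exact h2
  · intro f g g' hf hg hg'
    have h := hM _ _ (val_ok f hf) (val_ok g hg)
    have h' := hM _ _ (val_ok f hf) (val_ok g' hg')
    have h2 := ht2 _ _ _ (val_ok f hf) (val_ok g hg) (val_ok g' hg')
    rw [val_T (bm_ok g hg) _ h.2.1 h.2.2.2.1, val_T (bm_ok g hg) _ h'.2.1 h'.2.2.2.1] at h2
    exact h2
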